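/- Let X = ⋂_{n=0}^∞ (Xₙ, ‖·‖ₙ) and Y = ⋂_{n=0}^∞ (Yₙ, |·|ₙ) be compactly graded spaces. Let f : X → Y be continuous, directionally differentiable at every point, with f(0) = 0, and assume there are constants cₙ > 0 (n ≥ 0) such that for each x ∈ X and each v ∈ Y there exists u ∈ X with f'(x; u) = v and ‖u‖ₙ ≤ cₙ|v|ₙ for all n ≥ 0. Set b := (cₙ^{-1})ₙ₌₀^∞. Then for every s ∈ ℝ₊^∞, Π_{b·s}(Y) ⊆ f(Π_s(X)). -/

import Mathlib

open Filter Topology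
open scoped ENNReal

noncomputable section

/-- Monotonicity of `t ↦ t / (1 + t)` on nonnegative reals. -/
lemma gradedG_mono {a b : ℝ} (ha : 0 ≤ a) (hab : a ≤ b) :
    a / (1 + a) ≤ b / (1 + b) := by
  rw [div_le_div_iff₀ (by linarith) (by linarith)]
  nlinarith

/-- Subadditivity of `t ↦ t / (1 + t)` on nonnegative reals. -/
lemma gradedG_subadd {a b : ℝ} (ha : 0 ≤ a) (hb : 0 ≤ b) :
    (a + b) / (1 + (a + b)) ≤ a / (1 + a) + b / (1 + b) := by
  have h1 : (0:ℝ) < 1 + a := by linarith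
  have h2 : (0:ℝ) < 1 + b := by linarith
  have h3 : (0:ℝ) < 1 + (a + b) := by linarith
  rw [div_add_div _ _ h1.ne' h2.ne', div_le_div_iff₀ h3 (by positivity)]
  nlinarith [mul_nonneg ha hb, mul_nonneg (mul_nonneg ha hb) ha,
    mul_nonneg (mul_nonneg ha hb) hb]

variable (E : ℕ → Type) [∀ n, NormedAddCommGroup (E n)] [∀ n, NormedSpace ℝ (E n)]
variable (J : ∀ n, E (n + 1) →L[ℝ] E n)

/-- The inverse limit `X = ⋂ₙ Xₙ` of the system of inclusions `Jₙ : Xₙ₊₁ → Xₙ`,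
as a submodule of the product `∏ₙ Xₙ`. -/
def invLimSubmodule : Submodule ℝ (∀ n, E n) where
  carrier := {x | ∀ n, J n (x (n + 1)) = x n}
  add_mem' := by intro a b ha hb n; simp [ha n, hb n]
  zero_mem' := by intro n; simp
  smul_mem' := by intro c a ha n; simp [ha n]

/-- The inverse limit as a type; its elements carry all the norms `‖x.1 n‖`. -/
def InvLim : Type _ := ↥(invLimSubmodule E J)

instance : AddCommGroup (InvLim E J) :=
  inferInstanceAs (AddCommGroup ↥(invLimSubmodule E J))

instance : Module ℝ (InvLim E J) :=
  inferInstanceAs (Module ℝ ↥(invLimSubmodule E J))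

variable {E J}

/-- `n`-th term in the defining formula for the metric `ρ_X`. -/
def rhoTerm (x y : InvLim E J) (n : ℕ) : ℝ :=
  (2 : ℝ)⁻¹ ^ n * (‖x.1 n - y.1 n‖ / (1 + ‖x.1 n - y.1 n‖))

/-- The translation-invariant metric
`ρ_X(x,y) = max_n 2⁻ⁿ ‖x-y‖ₙ / (1 + ‖x-y‖ₙ)` on the inverse limit. -/
def rho (x y : InvLim E J) : ℝ := ⨆ n, rhoTerm x y n

lemma rhoTerm_nonneg (x y : InvLim E J) (n : ℕ) : 0 ≤ rhoTerm x y n := by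
  unfold rhoTerm; positivity

lemma rhoTerm_le_one (x y : InvLim E J) (n : ℕ) : rhoTerm x y n ≤ 1 := by
  unfold rhoTerm
  have h0 : (0:ℝ) ≤ ‖x.1 n - y.1 n‖ := norm_nonneg _
  have h1 : ‖x.1 n - y.1 n‖ / (1 + ‖x.1 n - y.1 n‖) ≤ 1 := by
    rw [div_le_one (by linarith)]; linarith
  have h2 : ((2:ℝ)⁻¹) ^ n ≤ 1 := pow_le_one₀ (by norm_num) (by norm_num)
  have h3 : (0:ℝ) ≤ ((2:ℝ)⁻¹) ^ n := by positivity
  nlinarith [div_nonneg h0 (by linarith : (0:ℝ) ≤ 1 + ‖x.1 n - y.1 n‖)]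

lemma rho_bddAbove (x y : InvLim E J) : BddAbove (Set.range (rhoTerm x y)) := by
  refine ⟨1, ?_⟩
  rintro r ⟨n, rfl⟩
  exact rhoTerm_le_one x y n

lemma rhoTerm_triangle (x y z : InvLim E J) (n : ℕ) :
    rhoTerm x z n ≤ rhoTerm x y n + rhoTerm y z n := by
  unfold rhoTerm
  set a := ‖x.1 n - y.1 n‖ with ha
  set b := ‖y.1 n - z.1 n‖ with hb
  have ha0 : 0 ≤ a := norm_nonneg _
  have hb0 : 0 ≤ b := norm_nonneg _
  have hxz : ‖x.1 n - z.1 n‖ ≤ a + b := by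
    simpa [dist_eq_norm, ha, hb] using dist_triangle (x.1 n) (y.1 n) (z.1 n)
  have step1 : ‖x.1 n - z.1 n‖ / (1 + ‖x.1 n - z.1 n‖) ≤ (a + b) / (1 + (a + b)) :=
    gradedG_mono (norm_nonneg _) hxz
  have step2 := gradedG_subadd ha0 hb0
  have hw : (0:ℝ) ≤ (2:ℝ)⁻¹ ^ n := by positivity
  calc (2:ℝ)⁻¹ ^ n * (‖x.1 n - z.1 n‖ / (1 + ‖x.1 n - z.1 n‖))
      ≤ (2:ℝ)⁻¹ ^ n * (a / (1 + a) + b / (1 + b)) :=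
        mul_le_mul_of_nonneg_left (step1.trans step2) hw
    _ = (2:ℝ)⁻¹ ^ n * (a / (1 + a)) + (2:ℝ)⁻¹ ^ n * (b / (1 + b)) := mul_add _ _ _

instance : MetricSpace (InvLim E J) where
  dist x y := rho x y
  dist_self x := by
    have h : ∀ n, rhoTerm x x n = 0 := by intro n; simp [rhoTerm]
    show rho x x = 0
    unfold rho
    simp [h]
  dist_comm x y := by
    show rho x y = rho y x
    unfold rho rhoTerm
    congr 1
    funext n
    rw [norm_sub_rev]
  dist_triangle x y z := by
    show rho x z ≤ rho x y + rho y z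
    refine ciSup_le fun n => ?_
    calc rhoTerm x z n ≤ rhoTerm x y n + rhoTerm y z n := rhoTerm_triangle x y z n
      _ ≤ rho x y + rho y z :=
        add_le_add (le_ciSup (rho_bddAbove x y) n) (le_ciSup (rho_bddAbove y z) n)
  eq_of_dist_eq_zero := by
    intro x y h
    have hxy : ∀ n, x.1 n = y.1 n := by
      intro n
      have h1 : rhoTerm x y n ≤ 0 := by
        have := le_ciSup (rho_bddAbove x y) n
        change rhoTerm x y n ≤ rho x y at this
        rwa [show rho x y = 0 from h] at this
      have h3 : rhoTerm x y n = 0 := le_antisymm h1 (rhoTerm_nonneg x y n)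
      unfold rhoTerm at h3
      have hw : (0:ℝ) < (2:ℝ)⁻¹ ^ n := by positivity
      have h4 : ‖x.1 n - y.1 n‖ / (1 + ‖x.1 n - y.1 n‖) = 0 := by
        rcases mul_eq_zero.1 h3 with h | h
        · exact absurd h hw.ne'
        · exact h
      have hd : (0:ℝ) < 1 + ‖x.1 n - y.1 n‖ := by positivity
      have h5 : ‖x.1 n - y.1 n‖ = 0 := by
        rcases div_eq_zero_iff.1 h4 with h' | h'
        · exact h'
        · exact absurd h' hd.ne'
      have := norm_eq_zero.1 h5
      exact sub_eq_zero.1 this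
    exact Subtype.ext (funext hxy)

variable (E J)

/-- `Π_s(X) = {x ∈ X : ‖x‖ₙ ≤ sₙ for all n}`. -/
def PiSet (s : ℕ → ℝ) : Set (InvLim E J) := {x | ∀ n, ‖x.1 n‖ ≤ s n}

end

section InvLim

variable {E : ℕ → Type} [∀ n, NormedAddCommGroup (E n)] [∀ n, NormedSpace ℝ (E n)]
variable {J : ∀ n, E (n + 1) →L[ℝ] E n}

/-- The coordinate maps of the inverse limit are continuous for the metric `rho`. -/
lemma InvLim.continuous_coord (n : ℕ) : Continuous fun x : InvLim E J => x.1 n := by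
  refine Metric.continuous_iff.2 fun x ε hε => ?_
  refine ⟨(2 : ℝ)⁻¹ ^ n * (ε / (1 + ε)), by positivity, fun y hy => ?_⟩
  rw [dist_eq_norm]
  by_contra! h
  have h1 : rhoTerm y x n ≤ dist y x := le_ciSup (rho_bddAbove y x) n
  have h2 : (2 : ℝ)⁻¹ ^ n * (ε / (1 + ε)) ≤ rhoTerm y x n :=
    mul_le_mul_of_nonneg_left (gradedG_mono hε.le h) (by positivity)
  linarith

/-- The identity from the inverse limit, as a subspace of the product, to the inverse limit with
the metric `rho`. -/
def InvLim.mk (x : ↥(invLimSubmodule E J)) : InvLim E J := x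

/-- The product topology on the inverse limit is finer than the topology of the metric `rho`. -/
lemma InvLim.continuous_mk : Continuous (InvLim.mk : ↥(invLimSubmodule E J) → InvLim E J) := by
  refine continuous_iff_continuousAt.2 fun x => Metric.tendsto_nhds.2 fun ε hε => ?_
  obtain ⟨N, hN⟩ := exists_pow_lt_of_lt_one (half_pos hε) (by norm_num : (2 : ℝ)⁻¹ < 1)
  have hev : ∀ᶠ y : ↥(invLimSubmodule E J) in 𝓝 x,
      ∀ n ∈ Set.Iio N, dist (y.1 n) (x.1 n) < ε / 2 := by
    refine (Filter.eventually_all_finite (Set.finite_Iio N)).2 fun n _ => ?_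
    exact Metric.tendsto_nhds.1
      (((continuous_apply n).comp continuous_subtype_val).tendsto x) _ (half_pos hε)
  filter_upwards [hev] with y hy
  refine lt_of_le_of_lt (ciSup_le fun n => ?_ : rho (E := E) (J := J) y x ≤ ε / 2) (half_lt_self hε)
  have h0 : 0 ≤ ‖y.1 n - x.1 n‖ := norm_nonneg _
  have hw0 : (0 : ℝ) ≤ (2 : ℝ)⁻¹ ^ n := by positivity
  change (2 : ℝ)⁻¹ ^ n * (‖y.1 n - x.1 n‖ / (1 + ‖y.1 n - x.1 n‖)) ≤ ε / 2
  rcases lt_or_ge n N with hn | hn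
  · have h1 : ‖y.1 n - x.1 n‖ < ε / 2 := by simpa [dist_eq_norm] using hy n hn
    have hw : (2 : ℝ)⁻¹ ^ n ≤ 1 := pow_le_one₀ (by norm_num) (by norm_num)
    have hq : ‖y.1 n - x.1 n‖ / (1 + ‖y.1 n - x.1 n‖) ≤ ‖y.1 n - x.1 n‖ :=
      div_le_self h0 (by linarith)
    exact (mul_le_of_le_one_left (by positivity) hw).trans (hq.trans h1.le)
  · have hw : (2 : ℝ)⁻¹ ^ n ≤ (2 : ℝ)⁻¹ ^ N :=
      pow_le_pow_of_le_one (by norm_num) (by norm_num) hn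
    have hq : ‖y.1 n - x.1 n‖ / (1 + ‖y.1 n - x.1 n‖) ≤ 1 :=
      (div_le_one (by linarith)).2 (by linarith)
    exact (mul_le_of_le_one_right hw0 hq).trans (hw.trans hN.le)

/-- If the connecting maps are compact operators, then the sets `PiSet E J s` are compact. -/
lemma isCompact_piSet (hJcpt : ∀ n, IsCompactOperator (J n)) (s : ℕ → ℝ) :
    IsCompact (PiSet E J s) := by
  have hC : ∀ n, IsCompact (closure (J n '' Metric.closedBall 0 (s (n + 1)))) := fun n =>
    (hJcpt n).isCompact_closure_image_closedBall (s (n + 1))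
  have hclosed : IsClosed (invLimSubmodule E J : Set (∀ n, E n)) := by
    have : (invLimSubmodule E J : Set (∀ n, E n)) = ⋂ n, {x | J n (x (n + 1)) = x n} := by
      ext x; simp [invLimSubmodule]
    rw [this]
    exact isClosed_iInter fun n => isClosed_eq (by fun_prop) (by fun_prop)
  have hcpt := (hclosed.isClosedEmbedding_subtypeVal.isCompact_preimage
    (isCompact_univ_pi hC)).image InvLim.continuous_mk
  refine hcpt.of_isClosed_subset ?_ fun x hx => ⟨x, fun n _ => subset_closure ?_, rfl⟩
  · have : PiSet E J s = ⋂ n, {x | ‖x.1 n‖ ≤ s n} := by ext x; simp [PiSet]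
    rw [this]
    exact isClosed_iInter fun n =>
      isClosed_le (InvLim.continuous_coord n).norm continuous_const
  · exact ⟨x.1 (n + 1), by simpa using hx (n + 1), x.2 n⟩

/-- If the connecting maps are injective, then an element of the inverse limit is determined by
its zeroth coordinate. -/
lemma InvLim.ext_coord_zero (hJinj : ∀ n, Function.Injective (J n)) {x y : InvLim E J}
    (h : x.1 0 = y.1 0) : x = y := by
  refine Subtype.ext (funext fun n => ?_)
  induction n with
  | zero => exact h
  | succ n ih => exact hJinj n (by rw [x.2 n, y.2 n, ih])

end InvLim

section Approximation

variable {E : ℕ → Type} [∀ n, NormedAddCommGroup (E n)] [∀ n, NormedSpace ℝ (E n)]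
variable {J : ∀ n, E (n + 1) →L[ℝ] E n}
variable {F : ℕ → Type} [∀ n, NormedAddCommGroup (F n)] [∀ n, NormedSpace ℝ (F n)]
variable {K : ∀ n, F (n + 1) →L[ℝ] F n}

/-- Approximate solvability of `f x = y` in the zeroth norm: the largest `t ∈ [0, 1]` for which
`f x = t • y` has an `ε * t`-approximate solution in `PiSet E J (t • s)` is `1`, because a solution
for `t < 1` can be continued along a direction in which the derivative of `f` is `y`. -/
lemma exists_approx_solution (hJcpt : ∀ n, IsCompactOperator (J n))
    {f : InvLim E J → InvLim F K} (hf : Continuous f) (hf0 : f 0 = 0)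
    (y : InvLim F K) {s : ℕ → ℝ} (hs : ∀ n, 0 ≤ s n)
    (hdir : ∀ x : InvLim E J, ∃ u ∈ PiSet E J s,
      Tendsto (fun t : ℝ => t⁻¹ • (f (x + t • u) - f x)) (𝓝[>] (0 : ℝ)) (𝓝 y))
    {ε : ℝ} (hε : 0 < ε) :
    ∃ x ∈ PiSet E J s, ‖(f x).1 0 - y.1 0‖ ≤ ε := by
  let S : Set (ℝ × InvLim E J) := {p | p.1 ∈ Set.Icc (0 : ℝ) 1 ∧ (∀ n, ‖p.2.1 n‖ ≤ p.1 * s n) ∧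
    ‖(f p.2).1 0 - p.1 • y.1 0‖ ≤ ε * p.1}
  have hcoord : ∀ n, Continuous fun p : ℝ × InvLim E J => p.2.1 n := fun n =>
    (InvLim.continuous_coord n).comp continuous_snd
  have hfcoord : Continuous fun p : ℝ × InvLim E J => (f p.2).1 0 :=
    (InvLim.continuous_coord 0).comp (hf.comp continuous_snd)
  have hSclosed : IsClosed S := by
    have hball : IsClosed {p : ℝ × InvLim E J | ∀ n, ‖p.2.1 n‖ ≤ p.1 * s n} := by
      rw [Set.ofPred_forall]
      exact isClosed_iInter fun n => isClosed_le (hcoord n).norm (by fun_prop)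
    exact (isClosed_Icc.preimage continuous_fst).inter
      (hball.inter (isClosed_le (hfcoord.sub (by fun_prop)).norm (by fun_prop)))
  have hSsub : S ⊆ Set.Icc (0 : ℝ) 1 ×ˢ PiSet E J s := fun p hp =>
    ⟨hp.1, fun n => (hp.2.1 n).trans (mul_le_of_le_one_left (hs n) hp.1.2)⟩
  have hScpt : IsCompact S :=
    (isCompact_Icc.prod (isCompact_piSet hJcpt s)).of_isClosed_subset hSclosed hSsub
  have hSne : S.Nonempty := by
    refine ⟨(0, 0), ⟨le_rfl, zero_le_one⟩, fun n => ?_, ?_⟩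
    · change ‖(0 : E n)‖ ≤ 0 * s n
      simp
    · change ‖(f 0).1 0 - (0 : ℝ) • y.1 0‖ ≤ ε * 0
      rw [hf0]
      change ‖(0 : F 0) - (0 : ℝ) • y.1 0‖ ≤ ε * 0
      simp
  obtain ⟨⟨t, x⟩, hp, hmax⟩ := hScpt.exists_isMaxOn hSne continuous_fst.continuousOn
  obtain ⟨⟨ht0, ht1⟩, hx, hfx⟩ := id hp
  dsimp only at ht0 ht1 hx hfx
  rcases ht1.eq_or_lt with rfl | ht
  · exact ⟨x, (hSsub hp).2, by simpa using hfx⟩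
  obtain ⟨u, hu, hlim⟩ := hdir x
  have hlim0 := Metric.tendsto_nhds.1 (((InvLim.continuous_coord 0).tendsto y).comp hlim) ε hε
  have hsmall : ∀ᶠ h : ℝ in 𝓝[>] 0, h ∈ Set.Ioo 0 (1 - t) :=
    Ioo_mem_nhdsGT (sub_pos.2 ht)
  obtain ⟨h, hq, hh0, hh1⟩ := (hlim0.and hsmall).exists
  have hq' : ‖h⁻¹ • ((f (x + h • u)).1 0 - (f x).1 0) - y.1 0‖ < ε := by
    rw [← dist_eq_norm]; exact hq
  have hstep : ‖(f (x + h • u)).1 0 - (f x).1 0 - h • y.1 0‖ ≤ ε * h := by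
    have : (f (x + h • u)).1 0 - (f x).1 0 - h • y.1 0 =
        h • (h⁻¹ • ((f (x + h • u)).1 0 - (f x).1 0) - y.1 0) := by
      rw [smul_sub, smul_inv_smul₀ hh0.ne']
    rw [this, norm_smul, Real.norm_of_nonneg hh0.le, mul_comm]
    exact mul_le_mul_of_nonneg_right hq'.le hh0.le
  have hmem : (t + h, x + h • u) ∈ S := by
    refine ⟨⟨by dsimp only; linarith, by dsimp only; linarith⟩, fun n => ?_, ?_⟩
    · calc ‖x.1 n + h • u.1 n‖ ≤ ‖x.1 n‖ + ‖h • u.1 n‖ := norm_add_le _ _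
        _ ≤ t * s n + h * s n := by
          rw [norm_smul, Real.norm_of_nonneg hh0.le]
          exact add_le_add (hx n) (mul_le_mul_of_nonneg_left (hu n) hh0.le)
        _ = (t + h) * s n := (add_mul _ _ _).symm
    · calc ‖(f (x + h • u)).1 0 - (t + h) • y.1 0‖
          = ‖((f x).1 0 - t • y.1 0) + ((f (x + h • u)).1 0 - (f x).1 0 - h • y.1 0)‖ := by
            rw [add_smul]; congr 1; abel
        _ ≤ ε * t + ε * h := (norm_add_le _ _).trans (add_le_add hfx hstep)
        _ = ε * (t + h) := (mul_add _ _ _).symm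
  have := hmax hmem
  have : t + h ≤ t := this
  linarith

end Approximation

/-- under the hypotheses of the main theorem with `d = 0`, and
`b = (cₙ⁻¹)ₙ`, one has `Π_{b·s}(Y) ⊆ f(Π_s(X))` for every `s ∈ ℝ₊^∞`. -/
theorem nash_moser_ekeland_piSet
    (E : ℕ → Type) [∀ n, NormedAddCommGroup (E n)] [∀ n, NormedSpace ℝ (E n)]
    [∀ n, CompleteSpace (E n)]
    (J : ∀ n, E (n + 1) →L[ℝ] E n)
    (hJinj : ∀ n, Function.Injective (J n))
    (hJcpt : ∀ n, IsCompactOperator (J n))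
    (F : ℕ → Type) [∀ n, NormedAddCommGroup (F n)] [∀ n, NormedSpace ℝ (F n)]
    [∀ n, CompleteSpace (F n)]
    (K : ∀ n, F (n + 1) →L[ℝ] F n)
    (hKinj : ∀ n, Function.Injective (K n))
    (hKcpt : ∀ n, IsCompactOperator (K n))
    (f : InvLim E J → InvLim F K) (hf : Continuous f) (hf0 : f 0 = 0)
    (D : InvLim E J → InvLim E J → InvLim F K)
    (hD : ∀ x h : InvLim E J,
      Tendsto (fun t : ℝ => t⁻¹ • (f (x + t • h) - f x)) (𝓝[>] (0 : ℝ)) (𝓝 (D x h)))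
    (c : ℕ → ℝ) (hc : ∀ n, 0 < c n)
    (hsol : ∀ x : InvLim E J, ∀ v : InvLim F K,
      ∃ u : InvLim E J, D x u = v ∧ ∀ n, ‖u.1 n‖ ≤ c n * ‖v.1 n‖)
    (s : ℕ → ℝ) (hs : ∀ n, 0 ≤ s n) :
    PiSet F K (fun n => (c n)⁻¹ * s n) ⊆ f '' PiSet E J s := by
  intro y hy
  have hdir : ∀ x : InvLim E J, ∃ u ∈ PiSet E J s,
      Tendsto (fun t : ℝ => t⁻¹ • (f (x + t • u) - f x)) (𝓝[>] (0 : ℝ)) (𝓝 y) := by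
    intro x
    obtain ⟨u, hDu, hu⟩ := hsol x y
    refine ⟨u, fun n => (hu n).trans ?_, hDu ▸ hD x u⟩
    calc c n * ‖y.1 n‖ ≤ c n * ((c n)⁻¹ * s n) := mul_le_mul_of_nonneg_left (hy n) (hc n).le
      _ = s n := mul_inv_cancel_left₀ (hc n).ne' _
  have happrox := fun ε (hε : 0 < ε) => exists_approx_solution hJcpt hf hf0 y hs hdir hε
  obtain ⟨z, hz, -⟩ := happrox 1 one_pos
  obtain ⟨x, hx, hmin⟩ := (isCompact_piSet hJcpt s).exists_isMinOn ⟨z, hz⟩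
    (((InvLim.continuous_coord 0).comp hf).sub continuous_const).norm.continuousOn
      (f := fun x => ‖(f x).1 0 - y.1 0‖)
  have hle : ‖(f x).1 0 - y.1 0‖ ≤ 0 := le_of_forall_pos_le_add fun ε hε => by
    obtain ⟨w, hw, hfw⟩ := happrox ε hε
    rw [zero_add]
    exact (hmin hw).trans hfw
  exact ⟨x, hx, InvLim.ext_coord_zero hKinj (sub_eq_zero.1 (norm_le_zero_iff.1 hle))⟩
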